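/- arXiv:2301.02141 — 8 statements merged into one kernel-verified Lean document; each statement's English description precedes it below -/
import Mathlib

section
/- Lang's formula: For all integers n ≥ 1 and k ≥ 0, the power sum satisfies S_k(n) = Σ_{m=0}^{min(k, n-1)} (-1)^m (n - m) σ_m(1,2,...,n) h_{k-m}(1,2,...,n). -/
/-- The `m`-th elementary symmetric function of the family `f` over the finite index set `s`:
the sum over all `m`-element subsets of `s` of the product of the values of `f`. -/
def esymmOn {ι R : Type*} [CommRing R] (s : Finset ι) (m : ℕ) (f : ι → R) : R :=
  ∑ t ∈ s.powersetCard m, ∏ i ∈ t, f i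

/-- The `m`-th complete homogeneous symmetric function of the family `f` over the finite
index set `s`: the sum over all multisets of elements of `s` of size `m` of the product
of the values of `f` (with multiplicity). -/
def hsymmOn {ι R : Type*} [DecidableEq ι] [CommRing R] (s : Finset ι) (m : ℕ) (f : ι → R) : R :=
  ∑ t ∈ s.sym m, ((t : Multiset ι).map f).prod

theorem Finset.sym_succ_insert {ι : Type*} [DecidableEq ι] (a : ι) (s : Finset ι) (m : ℕ) :
    (insert a s).sym (m + 1) = s.sym (m + 1) ∪ ((insert a s).sym m).image (Sym.cons a) := by
  ext t
  simp only [Finset.mem_union, Finset.mem_image, Finset.mem_sym_iff]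
  constructor
  · intro h
    by_cases ha : a ∈ t
    · obtain ⟨t', rfl⟩ := Sym.exists_cons_of_mem ha
      exact Or.inr ⟨t', fun b hb => h b (Sym.mem_cons_of_mem hb), rfl⟩
    · refine Or.inl fun b hb => (Finset.mem_insert.1 (h b hb)).resolve_left ?_
      rintro rfl
      exact ha hb
  · rintro (h | ⟨t', h, rfl⟩) b hb
    · exact Finset.mem_insert_of_mem (h b hb)
    · rcases Sym.mem_cons.1 hb with rfl | hb
      · exact Finset.mem_insert_self _ _
      · exact h b hb

section Recurrences

variable {ι R : Type*} [CommRing R] {s : Finset ι} (f : ι → R)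

theorem esymmOn_zero : esymmOn s 0 f = 1 := by
  simp [esymmOn]

theorem esymmOn_eq_zero_of_card_lt {m : ℕ} (h : s.card < m) : esymmOn s m f = 0 := by
  simp [esymmOn, Finset.powersetCard_eq_empty.2 h]

theorem esymmOn_empty_succ (m : ℕ) : esymmOn ∅ (m + 1) f = 0 :=
  esymmOn_eq_zero_of_card_lt f m.succ_pos

theorem hsymmOn_zero [DecidableEq ι] : hsymmOn s 0 f = 1 := by
  simp only [hsymmOn, Finset.sym_zero, Finset.sum_singleton]
  exact Multiset.prod_zero

theorem esymmOn_insert_succ [DecidableEq ι] {a : ι} (ha : a ∉ s) (m : ℕ) :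
    esymmOn (insert a s) (m + 1) f = esymmOn s (m + 1) f + f a * esymmOn s m f := by
  have not_mem {t : Finset ι} (ht : t ∈ s.powersetCard m) : a ∉ t :=
    fun h => ha ((Finset.mem_powersetCard.1 ht).1 h)
  unfold esymmOn
  rw [Finset.powersetCard_succ_insert ha, Finset.sum_union, Finset.sum_image, Finset.mul_sum]
  · congr 1
    exact Finset.sum_congr rfl fun t ht => Finset.prod_insert (not_mem ht)
  · intro t ht u hu h
    rw [← Finset.erase_insert (not_mem ht), h, Finset.erase_insert (not_mem hu)]
  · rw [Finset.disjoint_left]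
    intro t ht h
    obtain ⟨u, -, rfl⟩ := Finset.mem_image.1 h
    exact ha ((Finset.mem_powersetCard.1 ht).1 (Finset.mem_insert_self _ _))

theorem hsymmOn_insert_succ [DecidableEq ι] {a : ι} (ha : a ∉ s) (m : ℕ) :
    hsymmOn (insert a s) (m + 1) f = hsymmOn s (m + 1) f + f a * hsymmOn (insert a s) m f := by
  unfold hsymmOn
  rw [Finset.sym_succ_insert, Finset.sum_union, Finset.sum_image, Finset.mul_sum]
  · simp [Sym.coe_cons]
  · exact fun t _ u _ h => Sym.cons_inj_right a t u |>.1 h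
  · rw [Finset.disjoint_left]
    intro t ht h
    obtain ⟨u, -, rfl⟩ := Finset.mem_image.1 h
    exact ha (Finset.mem_sym_iff.1 ht a (Sym.mem_cons_self _ _))

end Recurrences

section GeneratingFunctions

open PowerSeries

variable {ι R : Type*} [CommRing R] {s : Finset ι} (f : ι → R)

/-- The generating function `∑ (-1)^m e_m X^m` of the signed elementary symmetric functions. -/
def esymmSeries (s : Finset ι) (f : ι → R) : R⟦X⟧ :=
  PowerSeries.mk fun m => (-1) ^ m * esymmOn s m f

/-- The generating function `∑ (-1)^m (|s| - m) e_m X^m`. -/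
def weightedEsymmSeries (s : Finset ι) (f : ι → R) : R⟦X⟧ :=
  PowerSeries.mk fun m => (-1) ^ m * ((s.card : R) - m) * esymmOn s m f

/-- The generating function `∑ h_m X^m` of the complete homogeneous symmetric functions. -/
def hsymmSeries [DecidableEq ι] (s : Finset ι) (f : ι → R) : R⟦X⟧ :=
  PowerSeries.mk fun m => hsymmOn s m f

theorem mk_pow_mul_one_sub_C_mul_X (r : R) :
    (PowerSeries.mk fun m => r ^ m) * (1 - C r * X) = 1 := by
  rw [mul_sub, mul_one, mul_left_comm]
  ext (_ | m)
  · simp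
  · simp [← mul_assoc, coeff_succ_mul_X, coeff_one, pow_succ']

variable [DecidableEq ι] {a : ι}

theorem esymmSeries_insert (ha : a ∉ s) :
    esymmSeries (insert a s) f = esymmSeries s f * (1 - C (f a) * X) := by
  rw [mul_sub, mul_one, mul_left_comm]
  ext (_ | m)
  · simp [esymmSeries, esymmOn_zero]
  · simp [esymmSeries, ← mul_assoc, coeff_succ_mul_X, esymmOn_insert_succ f ha]
    ring

theorem weightedEsymmSeries_insert (ha : a ∉ s) :
    weightedEsymmSeries (insert a s) f =
      weightedEsymmSeries s f * (1 - C (f a) * X) + esymmSeries s f := by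
  rw [mul_sub, mul_one, mul_left_comm]
  ext (_ | m)
  · simp [weightedEsymmSeries, esymmSeries, esymmOn_zero, ha]
  · simp [weightedEsymmSeries, esymmSeries, ← mul_assoc, coeff_succ_mul_X,
      esymmOn_insert_succ f ha, ha]
    ring

theorem hsymmSeries_insert_mul (ha : a ∉ s) :
    hsymmSeries (insert a s) f * (1 - C (f a) * X) = hsymmSeries s f := by
  rw [mul_sub, mul_one, mul_left_comm]
  ext (_ | m)
  · simp [hsymmSeries, hsymmOn_zero]
  · simp [hsymmSeries, ← mul_assoc, coeff_succ_mul_X, hsymmOn_insert_succ f ha]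

theorem esymmSeries_mul_hsymmSeries (s : Finset ι) :
    esymmSeries s f * hsymmSeries s f = 1 := by
  induction s using Finset.induction_on with
  | empty =>
    ext (_ | m)
    · simp [esymmSeries, hsymmSeries, esymmOn_zero, hsymmOn_zero]
    · rw [coeff_mul, Finset.sum_eq_zero, coeff_one, if_neg m.succ_ne_zero]
      rintro ⟨_ | i, _ | j⟩ h <;>
        simp_all [esymmSeries, hsymmSeries, esymmOn_empty_succ, hsymmOn]
  | insert a s ha ih =>
    rw [esymmSeries_insert f ha, mul_assoc, mul_comm (1 - _), hsymmSeries_insert_mul f ha, ih]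

theorem weightedEsymmSeries_mul_hsymmSeries (s : Finset ι) :
    weightedEsymmSeries s f * hsymmSeries s f =
      ∑ i ∈ s, PowerSeries.mk fun m => f i ^ m := by
  induction s using Finset.induction_on with
  | empty =>
    have : weightedEsymmSeries ∅ f = 0 := by
      ext (_ | m) <;> simp [weightedEsymmSeries, esymmOn_empty_succ]
    simp [this]
  | insert a s ha ih =>
    have h := hsymmSeries_insert_mul f ha
    have hgeom := mk_pow_mul_one_sub_C_mul_X (f a)
    have hEH := esymmSeries_mul_hsymmSeries f s
    rw [Finset.sum_insert ha, ← ih, weightedEsymmSeries_insert f ha]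
    set g := PowerSeries.mk fun m => f a ^ m
    linear_combination (weightedEsymmSeries s f + esymmSeries s f * g) * h + g * hEH -
      esymmSeries s f * hsymmSeries (insert a s) f * hgeom

/-- Lang's formula for the power sums of an arbitrary finite family. -/
theorem sum_pow_eq_sum_esymmOn_mul_hsymmOn (s : Finset ι) (k : ℕ) :
    ∑ i ∈ s, f i ^ k = ∑ m ∈ Finset.range (k + 1),
      (-1) ^ m * ((s.card : R) - m) * esymmOn s m f * hsymmOn s (k - m) f := by
  have h := congrArg (coeff k) (weightedEsymmSeries_mul_hsymmSeries f s)
  rw [coeff_mul, Finset.Nat.sum_antidiagonal_eq_sum_range_succ_mk] at h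
  simpa [weightedEsymmSeries, hsymmSeries] using h.symm

end GeneratingFunctions

/-- Lang's formula: for `n ≥ 1`, `k ≥ 0`,
`S_k(n) = ∑_{m=0}^{min(k,n-1)} (-1)^m (n-m) σ_m(1,…,n) h_{k-m}(1,…,n)`. -/
theorem lang_formula (n k : ℕ) (hn : 1 ≤ n) :
    ∑ i ∈ Finset.Icc 1 n, (i : ℤ) ^ k =
      ∑ m ∈ Finset.range (min k (n - 1) + 1), (-1) ^ m * ((n : ℤ) - m) *
        esymmOn (Finset.Icc 1 n) m (fun i => (i : ℤ)) *
        hsymmOn (Finset.Icc 1 n) (k - m) (fun i => (i : ℤ)) := by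
  have h := sum_pow_eq_sum_esymmOn_mul_hsymmOn (fun i : ℕ => (i : ℤ)) (Finset.Icc 1 n) k
  rw [Nat.card_Icc, Nat.add_sub_cancel] at h
  rw [h]
  symm
  refine Finset.sum_subset (Finset.range_mono (by omega)) fun m hm hm' => ?_
  rw [Finset.mem_range] at hm hm'
  obtain rfl | hlt : n = m ∨ n < m := by omega
  · simp
  · rw [esymmOn_eq_zero_of_card_lt _ (by simpa using hlt)]
    simp
end

section
/- For all integers n ≥ 1 and m ≥ 1, the power sum satisfies the recurrence S_m(n) = m! · C(n+m, m+1) − Σ_{j=1}^{m-1} σ_j(1,2,...,m-1) S_{m-j}(n), where C(a,b) denotes the binomial coefficient and the summation is empty when m = 1. -/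
theorem prod_add_eq_sum_esymmOn {ι R : Type*} [DecidableEq ι] [CommRing R] (s : Finset ι)
    (f : ι → R) (x : R) :
    ∏ a ∈ s, (x + f a) = ∑ j ∈ Finset.range (s.card + 1), esymmOn s j f * x ^ (s.card - j) := by
  simp_rw [add_comm x]
  rw [Finset.prod_add, Finset.sum_powerset]
  refine Finset.sum_congr rfl fun j _ => ?_
  rw [esymmOn, Finset.sum_mul]
  refine Finset.sum_congr rfl fun t ht => ?_
  obtain ⟨hts, rfl⟩ := Finset.mem_powersetCard.mp ht
  rw [Finset.prod_const, Finset.card_sdiff_of_subset hts]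

theorem mul_prod_Icc_add_eq_factorial_mul_choose (n k : ℕ) :
    (n + 1) * ∏ a ∈ Finset.Icc 1 k, (n + 1 + a) =
      (k + 1).factorial * (n + 1 + k).choose (k + 1) := by
  have h := Nat.ascFactorial_eq_factorial_mul_choose n (k + 1)
  rw [Nat.ascFactorial_eq_prod_range, Finset.prod_range_succ', add_zero, mul_comm] at h
  rw [show n + 1 + k = n + (k + 1) by ring, ← h, ← Finset.Ico_add_one_right_eq_Icc,
    Finset.prod_Ico_eq_prod_range]
  simp [add_comm 1]

theorem sum_mul_prod_Icc_add (n k : ℕ) :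
    ∑ i ∈ Finset.Icc 1 n, i * ∏ a ∈ Finset.Icc 1 k, (i + a) =
      (k + 1).factorial * (n + (k + 1)).choose (k + 2) := by
  induction n with
  | zero => simp
  | succ n ih =>
    rw [Finset.sum_Icc_succ_top (by omega), ih, mul_prod_Icc_add_eq_factorial_mul_choose,
      show n + 1 + (k + 1) = (n + (k + 1)) + 1 by ring, Nat.choose_succ_succ (n + (k + 1)) (k + 1),
      show n + 1 + k = n + (k + 1) by ring]
    ring

/-- For `n ≥ 1`, `m ≥ 1`,
`S_m(n) = m! · C(n+m, m+1) − ∑_{j=1}^{m-1} σ_j(1,…,m-1) S_{m-j}(n)`. -/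
theorem power_sum_recurrence (n m : ℕ) (hn : 1 ≤ n) (hm : 1 ≤ m) :
    ∑ i ∈ Finset.Icc 1 n, (i : ℤ) ^ m =
      (Nat.factorial m : ℤ) * (Nat.choose (n + m) (m + 1) : ℤ) -
        ∑ j ∈ Finset.Icc 1 (m - 1),
          esymmOn (Finset.Icc 1 (m - 1)) j (fun i => (i : ℤ)) *
          (∑ i ∈ Finset.Icc 1 n, (i : ℤ) ^ (m - j)) := by
  obtain ⟨k, rfl⟩ := Nat.exists_eq_add_of_le' hm
  rw [Nat.add_sub_cancel, ← Nat.cast_mul, ← sum_mul_prod_Icc_add]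
  push_cast
  rw [eq_sub_iff_add_eq]
  simp_rw [Finset.mul_sum]
  rw [Finset.sum_comm, ← Finset.sum_add_distrib]
  refine Finset.sum_congr rfl fun i _ => ?_
  rw [prod_add_eq_sum_esymmOn, Nat.card_Icc, Nat.add_sub_cancel, Finset.sum_range_succ', mul_add,
    Finset.mul_sum, add_comm, ← Finset.Ico_add_one_right_eq_Icc, Finset.sum_Ico_eq_sum_range,
    Nat.add_sub_cancel]
  congr 1
  · refine Finset.sum_congr rfl fun j hj => ?_
    have hjk := Finset.mem_range.mp hj
    rw [show k + 1 - (1 + j) = k - (j + 1) + 1 by omega, add_comm 1 j, pow_succ]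
    ring
  · simp [esymmOn, pow_succ']
end

section
/- For all integers k ≥ 1 and n ≥ 1, Σ_{m=1}^{k} (-1)^{m-1} m · C(n, m) · C(n+k−m−1, k−m) = n, where C(a,b) denotes the binomial coefficient. -/
open PowerSeries in
/-- The coefficients of the power series `(1 - X) ^ n` are signed binomial coefficients. -/
theorem PowerSeries.coeff_one_sub_X_pow_eq (n j : ℕ) :
    coeff j ((1 - X : ℤ⟦X⟧) ^ n) = (-1) ^ j * (n.choose j : ℤ) := by
  induction n generalizing j with
  | zero => cases j <;> simp [coeff_one]
  | succ n ih =>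
    rw [pow_succ, mul_sub, mul_one, map_sub]
    cases j with
    | zero => simp [ih]
    | succ j =>
      rw [coeff_succ_mul_X, ih, ih, Nat.choose_succ_succ]
      push_cast
      ring

open PowerSeries in
/-- Comparing coefficients in `(1 - X) ^ n * (1 - X)⁻¹ ^ (n + 1) = (1 - X)⁻¹`. -/
theorem sum_neg_one_pow_mul_choose_mul_choose_eq_one (n k : ℕ) :
    ∑ j ∈ Finset.range (k + 1),
      (-1) ^ j * (n.choose j : ℤ) * ((n + (k - j)).choose (k - j) : ℤ) = 1 := by
  have h : (1 - X : ℤ⟦X⟧) ^ n * (mk 1) ^ (n + 1) = mk 1 := by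
    rw [pow_succ, ← mul_assoc, ← mul_pow, mul_comm (1 - X), mk_one_mul_one_sub_eq_one,
      one_pow, one_mul]
  have hc := congrArg (coeff k) h
  rw [mk_one_pow_eq_mk_choose_add, coeff_mul,
    Finset.Nat.sum_antidiagonal_eq_sum_range_succ_mk, coeff_mk, Pi.one_apply] at hc
  refine Eq.trans ?_ hc
  refine Finset.sum_congr rfl fun j _ => ?_
  rw [coeff_one_sub_X_pow_eq, coeff_mk, Nat.choose_symm_add]

/-- For `k ≥ 1`, `n ≥ 1`, `∑_{m=1}^{k} (-1)^{m-1} m·C(n,m)·C(n+k−m−1, k−m) = n`. -/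
theorem binomial_lang_identity (k n : ℕ) (hk : 1 ≤ k) (hn : 1 ≤ n) :
    ∑ m ∈ Finset.Icc 1 k, (-1) ^ (m - 1) * (m : ℤ) * (Nat.choose n m : ℤ) *
        (Nat.choose (n + k - m - 1) (k - m) : ℤ) = (n : ℤ) := by
  obtain ⟨K, rfl⟩ := Nat.exists_eq_add_of_le' hk
  obtain ⟨N, rfl⟩ := Nat.exists_eq_add_of_le' hn
  rw [← Finset.Ico_add_one_right_eq_Icc, Finset.sum_Ico_eq_sum_range, Nat.add_sub_cancel]
  refine Eq.trans ?_ ((congrArg (((N + 1 : ℕ) : ℤ) * ·)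
    (sum_neg_one_pow_mul_choose_mul_choose_eq_one N K)).trans (mul_one _))
  rw [Finset.mul_sum]
  refine Finset.sum_congr rfl fun j hj => ?_
  have hjK : j ≤ K := Nat.lt_succ_iff.mp (Finset.mem_range.mp hj)
  have habs : ((N + 1 : ℕ) : ℤ) * (N.choose j : ℤ)
      = ((N + 1).choose (j + 1) : ℤ) * ((j + 1 : ℕ) : ℤ) := by
    exact_mod_cast Nat.add_one_mul_choose_eq N j
  rw [add_comm 1 j, Nat.add_sub_cancel, Nat.add_sub_add_right,
    show N + 1 + (K + 1) - (j + 1) - 1 = N + (K - j) by omega]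
  linear_combination (-(-1) ^ j * ((N + (K - j)).choose (K - j) : ℤ)) * habs
end

section
/- For all integers n ≥ 1 and k ≥ 0, the sum of even powers of the first n odd positive integers satisfies 1^{2k} + 3^{2k} + ⋯ + (2n−1)^{2k} = (2^{2k}/(2k+1)) Σ_{j=0}^{k} C(2k+1, 2j+1) B_{2k−2j}(1/2) n^{2j+1}, where C(a,b) is the binomial coefficient and B_m(x) is the m-th Bernoulli polynomial. -/
namespace Polynomial

theorem natDegree_bernoulli_le (n : ℕ) : (bernoulli n).natDegree ≤ n := by
  rw [natDegree_le_iff_coeff_eq_zero]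
  intro i hi
  rw [coeff_bernoulli, if_neg (by omega)]

theorem hasseDeriv_bernoulli (n k : ℕ) (hk : k ≤ n) :
    hasseDeriv k (bernoulli n) = (n.choose k : ℚ) • bernoulli (n - k) := by
  ext i
  rw [hasseDeriv_coeff, coeff_smul, coeff_bernoulli, coeff_bernoulli]
  by_cases h : i + k ≤ n
  · have hc : (n.choose (i + k) * (i + k).choose k : ℚ) = n.choose k * (n - k).choose i := by
      have := Nat.choose_mul (n := n) (Nat.le_add_left k i)
      rw [Nat.add_sub_cancel] at this
      exact_mod_cast this
    rw [if_pos h, if_pos (by omega), show n - k - i = n - (i + k) by omega, smul_eq_mul]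
    linear_combination _root_.bernoulli (n - (i + k)) * hc
  · rw [if_neg h, if_neg (by omega), mul_zero, smul_zero]

/-- The addition formula for Bernoulli polynomials. -/
theorem bernoulli_eval_add (n : ℕ) (x y : ℚ) :
    (bernoulli n).eval (y + x) =
      ∑ i ∈ Finset.range (n + 1), (n.choose i : ℚ) * (bernoulli (n - i)).eval x * y ^ i := by
  have hdeg : (taylor x (bernoulli n)).natDegree < n + 1 := by
    rw [natDegree_taylor]
    exact Nat.lt_succ_of_le (natDegree_bernoulli_le n)
  rw [← taylor_eval, eval_eq_sum_range' hdeg]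
  refine Finset.sum_congr rfl fun i hi => ?_
  rw [taylor_coeff, hasseDeriv_bernoulli n i (Finset.mem_range_succ_iff.mp hi), eval_smul,
    smul_eq_mul]

theorem bernoulli_eval_one_half_of_odd {n : ℕ} (hn : Odd n) :
    (bernoulli n).eval (1 / 2 : ℚ) = 0 := by
  have h := bernoulli_eval_one_sub n (1 / 2)
  rw [hn.neg_one_pow, show (1 - 1 / 2 : ℚ) = 1 / 2 by norm_num] at h
  linarith

theorem sum_Icc_sub_one_half_pow (n p : ℕ) :
    (p + 1 : ℚ) * ∑ i ∈ Finset.Icc 1 n, ((i : ℚ) - 1 / 2) ^ p =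
      (bernoulli (p + 1)).eval (n + 1 / 2 : ℚ) - (bernoulli (p + 1)).eval (1 / 2 : ℚ) := by
  induction n with
  | zero => simp
  | succ n ih =>
    have h := bernoulli_eval_one_add (p + 1) (n + 1 / 2)
    rw [← add_assoc, add_comm 1 (n : ℚ), Nat.add_sub_cancel] at h
    rw [Finset.sum_Icc_succ_top (Nat.le_add_left 1 n), mul_add, ih]
    push_cast at h ⊢
    rw [h, show (n + 1 - 1 / 2 : ℚ) = n + 1 / 2 by ring]
    ring

end Polynomial

theorem Finset.sum_range_two_mul {M : Type*} [AddCommMonoid M] (f : ℕ → M) (n : ℕ) :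
    ∑ i ∈ range (2 * n), f i = ∑ j ∈ range n, (f (2 * j) + f (2 * j + 1)) := by
  induction n with
  | zero => simp
  | succ n ih =>
    rw [sum_range_succ, ← ih, Nat.mul_succ, sum_range_succ, sum_range_succ, add_assoc]

/-- For `n ≥ 1`, `k ≥ 0`, `1^{2k} + 3^{2k} + ⋯ + (2n−1)^{2k}
= (2^{2k}/(2k+1)) ∑_{j=0}^{k} C(2k+1, 2j+1) B_{2k−2j}(1/2) n^{2j+1}`,
where `B_m` is the `m`-th Bernoulli polynomial. -/
theorem odd_even_power_sum_bernoulli (n k : ℕ) (hn : 1 ≤ n) :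
    ∑ i ∈ Finset.Icc 1 n, (2 * (i : ℚ) - 1) ^ (2 * k) =
      (2 : ℚ) ^ (2 * k) / (2 * k + 1) *
        ∑ j ∈ Finset.range (k + 1), (Nat.choose (2 * k + 1) (2 * j + 1) : ℚ) *
          (Polynomial.bernoulli (2 * k - 2 * j)).eval (1 / 2 : ℚ) * (n : ℚ) ^ (2 * j + 1) := by
  have hodd : Odd (2 * k + 1) := odd_two_mul_add_one k
  have hsum : ∑ i ∈ Finset.Icc 1 n, (2 * (i : ℚ) - 1) ^ (2 * k) =
      2 ^ (2 * k) * ∑ i ∈ Finset.Icc 1 n, ((i : ℚ) - 1 / 2) ^ (2 * k) := by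
    rw [Finset.mul_sum]
    refine Finset.sum_congr rfl fun i _ => ?_
    rw [← mul_pow]
    ring
  have hexp := Polynomial.sum_Icc_sub_one_half_pow n (2 * k)
  rw [Polynomial.bernoulli_eval_one_half_of_odd hodd, sub_zero, Polynomial.bernoulli_eval_add,
    show 2 * k + 1 + 1 = 2 * (k + 1) by ring, Finset.sum_range_two_mul] at hexp
  push_cast at hexp
  rw [hsum, div_mul_eq_mul_div, eq_div_iff (by positivity), mul_assoc, mul_comm (Finset.sum _ _),
    hexp]
  congr 1
  refine Finset.sum_congr rfl fun j hj => ?_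
  have hj' := Finset.mem_range_succ_iff.mp hj
  have hodd' : Odd (2 * k + 1 - 2 * j) := ⟨k - j, by omega⟩
  rw [Polynomial.bernoulli_eval_one_half_of_odd hodd']
  ring
end

section
/- For every integer k ≥ 1, Σ_{j=0}^{k} (-1)^j C(k, j) B_{k+j+1}/(k+j+1) = 1/((k+1) C(2k+2, k+1)), where B_m denotes the m-th Bernoulli number and C(a,b) the binomial coefficient. -/
open Polynomial in
/-- The linear functional on rational polynomials sending `X ^ n` to `a n`. -/
noncomputable def momentFunctional (a : ℕ → ℚ) : ℚ[X] →ₗ[ℚ] ℚ :=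
  Polynomial.lsum fun n => a n • LinearMap.id

open Polynomial in
theorem momentFunctional_X_pow (a : ℕ → ℚ) (n : ℕ) : momentFunctional a (X ^ n) = a n := by
  simp [momentFunctional, X_pow_eq_monomial, sum_monomial_index]

open Polynomial in
theorem momentFunctional_X_pow_mul_one_sub_X_pow (a : ℕ → ℚ) (m n : ℕ) :
    momentFunctional a (X ^ m * (1 - X) ^ n) =
      ∑ j ∈ Finset.range (n + 1), (-1) ^ j * (n.choose j : ℚ) * a (m + j) := by
  have h : (X ^ m * (1 - X) ^ n : ℚ[X]) =
      ∑ j ∈ Finset.range (n + 1), ((-1) ^ j * (n.choose j : ℚ)) • X ^ (m + j) := by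
    rw [sub_eq_neg_add, add_pow, Finset.mul_sum]
    refine Finset.sum_congr rfl fun j _ => ?_
    rw [neg_pow, smul_eq_C_mul, pow_add]
    simp only [one_pow, map_mul, map_pow, map_neg, map_one, map_natCast]
    ring
  simp [h, momentFunctional_X_pow]

open Polynomial in
/-- The beta integral `∫₀¹ x ^ m * (1 - x) ^ n`. -/
theorem momentFunctional_inv_beta (m n : ℕ) :
    momentFunctional (fun i => 1 / ((i : ℚ) + 1)) (X ^ m * (1 - X) ^ n) =
      (m.factorial * n.factorial : ℚ) / (m + n + 1).factorial := by
  induction n generalizing m with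
  | zero =>
    have := Nat.factorial_ne_zero m
    simp [momentFunctional_X_pow, Nat.factorial_succ]
    field_simp
  | succ n ih =>
    have h : (X ^ m * (1 - X) ^ (n + 1) : ℚ[X]) =
        X ^ m * (1 - X) ^ n - X ^ (m + 1) * (1 - X) ^ n := by ring
    have hf : ((m + n + 1).factorial : ℚ) ≠ 0 := mod_cast Nat.factorial_ne_zero _
    rw [h, map_sub, ih, ih, show m + 1 + n + 1 = m + n + 1 + 1 by ring,
      show m + (n + 1) + 1 = m + n + 1 + 1 by ring, Nat.factorial_succ (m + n + 1),
      Nat.factorial_succ m, Nat.factorial_succ n]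
    push_cast
    field_simp
    ring

theorem sum_neg_one_pow_mul_choose_mul_bernoulli_div (m : ℕ) :
    ∑ j ∈ Finset.range (m + 1),
        (-1) ^ j * (m.choose j : ℚ) * (bernoulli (j + 1) / ((j : ℚ) + 1)) =
      1 / ((m : ℚ) + 1) - bernoulli (m + 1) / ((m : ℚ) + 1) - 0 ^ m - 1 := by
  have hm : (m : ℚ) + 1 ≠ 0 := by positivity
  have hterm : ∀ j ∈ Finset.range (m + 1),
      (-1) ^ j * (m.choose j : ℚ) * (bernoulli (j + 1) / ((j : ℚ) + 1)) =
        -(((m + 1).choose (j + 1) : ℚ) * bernoulli' (j + 1)) / ((m : ℚ) + 1) := by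
    intro j _
    have hj : (j : ℚ) + 1 ≠ 0 := by positivity
    have hc : ((m : ℚ) + 1) * m.choose j = (m + 1).choose (j + 1) * ((j : ℚ) + 1) :=
      mod_cast Nat.add_one_mul_choose_eq m j
    rw [bernoulli'_eq_bernoulli, pow_succ]
    field_simp
    linear_combination (bernoulli (j + 1)) * hc
  have hsum := sum_bernoulli' (m + 1)
  rw [Finset.sum_range_succ'] at hsum
  rw [Finset.sum_congr rfl hterm, ← Finset.sum_div, Finset.sum_neg_distrib,
    Finset.sum_range_succ]
  simp only [Nat.choose_zero_right, Nat.choose_self, bernoulli'_zero, Nat.cast_one, one_mul] at *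
  rw [eq_sub_of_add_eq hsum]
  rcases Nat.eq_zero_or_pos m with rfl | hpos
  · norm_num
  · rw [← bernoulli_eq_bernoulli'_of_ne_one (by lia), zero_pow hpos.ne']
    push_cast
    field_simp
    ring

open Polynomial in
/-- The reflection formula for the functional `X ^ n ↦ B_{n+1} / (n + 1)`. -/
theorem momentFunctional_bernoulli_comp_one_sub_X (p : ℚ[X]) :
    momentFunctional (fun i => _root_.bernoulli (i + 1) / ((i : ℚ) + 1)) (p.comp (1 - X)) +
        momentFunctional (fun i => _root_.bernoulli (i + 1) / ((i : ℚ) + 1)) p =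
      momentFunctional (fun i => 1 / ((i : ℚ) + 1)) p - p.eval 0 - p.eval 1 := by
  induction p using Polynomial.induction_on' with
  | add p q hp hq =>
    simp only [add_comp, map_add, eval_add]
    linear_combination hp + hq
  | monomial n c =>
    have h := momentFunctional_X_pow_mul_one_sub_X_pow
      (fun i => _root_.bernoulli (i + 1) / ((i : ℚ) + 1)) 0 n
    simp only [zero_add, pow_zero, one_mul] at h
    rw [sum_neg_one_pow_mul_choose_mul_bernoulli_div] at h
    simp only [← smul_X_eq_monomial, smul_comp, X_pow_comp, map_smul, momentFunctional_X_pow, h,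
      eval_smul, eval_pow, eval_X, smul_eq_mul, one_pow]
    ring

/-- For `k ≥ 1`, `∑_{j=0}^{k} (-1)^j C(k,j) B_{k+j+1}/(k+j+1) = 1/((k+1)C(2k+2,k+1))`,
where `B_m` is the `m`-th Bernoulli number. -/
theorem bernoulli_binomial_identity (k : ℕ) (hk : 1 ≤ k) :
    ∑ j ∈ Finset.range (k + 1), (-1) ^ j * (Nat.choose k j : ℚ) *
        bernoulli (k + j + 1) / (k + j + 1) =
      1 / ((k + 1) * (Nat.choose (2 * k + 2) (k + 1) : ℚ)) := by
  have hk0 : k ≠ 0 := by lia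
  have hrefl := momentFunctional_bernoulli_comp_one_sub_X
    (Polynomial.X ^ k * (1 - Polynomial.X) ^ k)
  have hcomp : (Polynomial.X ^ k * (1 - Polynomial.X) ^ k : Polynomial ℚ).comp
      (1 - Polynomial.X) = Polynomial.X ^ k * (1 - Polynomial.X) ^ k := by
    simp [mul_comm]
  rw [hcomp, momentFunctional_inv_beta, momentFunctional_X_pow_mul_one_sub_X_pow] at hrefl
  simp only [Polynomial.eval_mul, Polynomial.eval_pow, Polynomial.eval_sub, Polynomial.eval_X,
    Polynomial.eval_one, sub_self, zero_pow hk0, zero_mul, mul_zero, sub_zero, Nat.cast_add,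
    ← mul_div_assoc] at hrefl
  have hchoose : ((2 * k + 2).choose (k + 1) : ℚ) =
      (2 * k + 2).factorial / ((k + 1).factorial * (k + 1).factorial) := by
    rw [Nat.cast_choose ℚ (by lia), show 2 * k + 2 - (k + 1) = k + 1 by lia]
  have hf : ((2 * k + 1).factorial : ℚ) ≠ 0 := mod_cast Nat.factorial_ne_zero _
  have hf' : (k.factorial : ℚ) ≠ 0 := mod_cast Nat.factorial_ne_zero _
  have hrhs : 1 / (((k : ℚ) + 1) * (2 * k + 2).choose (k + 1)) =
      (k.factorial * k.factorial : ℚ) / (k + k + 1).factorial / 2 := by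
    rw [hchoose, ← two_mul, Nat.factorial_succ (2 * k + 1), Nat.factorial_succ k]
    push_cast
    field_simp
    ring
  rw [hrhs]
  linear_combination hrefl / 2
end

section
/- For every integer k ≥ 1, the k-th elementary symmetric function of the reciprocals of the squares of the positive integers satisfies Σ_{S} ∏_{n ∈ S} 1/n^2 = π^{2k}/(2k+1)!, where the sum ranges over all k-element finite subsets S of the positive integers. -/
/-- The Euler product for `sin`, expanded as a sum over all finite sets of positive integers. -/
theorem hasSum_finset_prod_div_sq (x : ℂ) (hx : x ≠ 0) :
    HasSum (fun S : Finset ℕ+ => ∏ n ∈ S, -x ^ 2 / (n : ℂ) ^ 2)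
      (Complex.sin (Real.pi * x) / (Real.pi * x)) := by
  have hnat : Summable fun n : ℕ => ‖-x ^ 2 / (n : ℂ) ^ 2‖ := by
    have h := (Real.summable_one_div_nat_pow.mpr one_lt_two).mul_left (‖x‖ ^ 2)
    refine h.congr fun n => ?_
    simp [div_eq_mul_inv]
  have hnorm : Summable fun n : ℕ+ => ‖-x ^ 2 / (n : ℂ) ^ 2‖ :=
    hnat.comp_injective PNat.coe_injective
  have hsum := summable_finsetProd_of_summable_norm hnorm
  have hprod := hasProd_one_add_of_hasSum_prod hsum.hasSum
  have hlim := (Equiv.pnatEquivNat.symm.hasProd_iff.mpr hprod).tendsto_prod_nat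
  have hpi : (Real.pi : ℂ) * x ≠ 0 :=
    mul_ne_zero (Complex.ofReal_ne_zero.mpr Real.pi_ne_zero) hx
  have hsin := (Complex.tendsto_euler_sin_prod x).div_const (Real.pi * x)
  rw [← tendsto_nhds_unique hlim (hsin.congr fun n => ?_)]
  · exact hsum.hasSum
  · rw [mul_div_cancel_left₀ _ hpi]
    refine Finset.prod_congr rfl fun j _ => ?_
    simp [sub_eq_add_neg, neg_div]

/-- The generating function of the elementary symmetric functions of `1/1², 1/2², …`. -/
theorem hasSum_pow_mul_esymm_inv_squares (z : ℂ) (hz : z ≠ 0) :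
    ∃ s : ℂ,
      HasSum (fun k : ℕ => z ^ k *
        ∑' S : {S : Finset ℕ+ // S.card = k}, ∏ n ∈ (S : Finset ℕ+), (1 / (n : ℂ) ^ 2)) s ∧
      HasSum (fun k : ℕ => z ^ k * ((Real.pi : ℂ) ^ (2 * k) / (Nat.factorial (2 * k + 1) : ℂ))) s := by
  obtain ⟨x, hxz⟩ := IsAlgClosed.exists_pow_nat_eq (-z) zero_lt_two
  obtain rfl : z = -x ^ 2 := by rw [hxz, neg_neg]
  have hx : x ≠ 0 := by rintro rfl; simp at hz
  refine ⟨Complex.sin (Real.pi * x) / (Real.pi * x), ?_, ?_⟩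
  · have h := (Equiv.sigmaFiberEquiv (Finset.card (α := ℕ+))).hasSum_iff.mpr
      (hasSum_finset_prod_div_sq x hx)
    have hfib := h.sigma fun k => (h.summable.sigma_factor k).hasSum
    refine hfib.congr_fun fun k => ?_
    rw [← tsum_mul_left]
    refine tsum_congr fun S => ?_
    simp only [Function.comp_apply, Equiv.sigmaFiberEquiv, Equiv.coe_fn_mk]
    have hc : (-x ^ 2) ^ k = ∏ _n ∈ (S : Finset ℕ+), (-x ^ 2) := by rw [Finset.prod_const, S.2]
    rw [hc, ← Finset.prod_mul_distrib]
    simp [div_eq_mul_inv]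
  · have hpi : (Real.pi : ℂ) ≠ 0 := Complex.ofReal_ne_zero.mpr Real.pi_ne_zero
    refine ((Complex.hasSum_sin (Real.pi * x)).div_const (Real.pi * x)).congr_fun fun k => ?_
    have hf : (Nat.factorial (2 * k + 1) : ℂ) ≠ 0 := mod_cast Nat.factorial_ne_zero _
    rw [neg_pow, ← pow_mul]
    field_simp
    ring

/-- Coefficients of power series agreeing on a punctured neighbourhood of `0` are equal. -/
theorem coeff_eq_of_hasSum_pow_mul {a b : ℕ → ℂ} (h₀ : a 0 = b 0)
    (h : ∀ z : ℂ, z ≠ 0 → ∃ s, HasSum (fun k => z ^ k * a k) s ∧ HasSum (fun k => z ^ k * b k) s) :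
    a = b := by
  have hall (z : ℂ) :
      ∃ s, HasSum (fun k => z ^ k * a k) s ∧ HasSum (fun k => z ^ k * b k) s := by
    by_cases hz : z = 0
    · subst hz
      have hsingle (c : ℕ → ℂ) : HasSum (fun k => (0 : ℂ) ^ k * c k) (c 0) := by
        simpa using hasSum_single (f := fun k => (0 : ℂ) ^ k * c k) 0 fun k hk => by simp [hk]
      exact ⟨a 0, hsingle a, h₀ ▸ hsingle b⟩
    · exact h z hz
  choose s hsa hsb using hall
  have hps (c : ℕ → ℂ) (hc : ∀ z, HasSum (fun k => z ^ k * c k) (s z)) :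
      HasFPowerSeriesAt s (FormalMultilinearSeries.ofScalars ℂ c) 0 := by
    rw [hasFPowerSeriesAt_iff]
    refine Filter.Eventually.of_forall fun z => ?_
    simpa [FormalMultilinearSeries.coeff_ofScalars] using hc z
  have heq := (hps a hsa).eq_formalMultilinearSeries (hps b hsb)
  funext k
  simpa [FormalMultilinearSeries.coeff_ofScalars] using congrArg (fun p => p.coeff k) heq


/-- For `k ≥ 1`, the `k`-th elementary symmetric function of `1/1², 1/2², 1/3², …` satisfies
`∑_{S} ∏_{n ∈ S} 1/n² = π^{2k}/(2k+1)!`, the sum ranging over all `k`-element finite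
subsets `S` of the positive integers. -/
theorem esymm_inv_squares (k : ℕ) (hk : 1 ≤ k) :
    ∑' S : {S : Finset ℕ+ // S.card = k}, ∏ n ∈ (S : Finset ℕ+), (1 / (n : ℝ) ^ 2) =
      Real.pi ^ (2 * k) / (Nat.factorial (2 * k + 1) : ℝ) := by
  have h := congrFun (coeff_eq_of_hasSum_pow_mul ?_ hasSum_pow_mul_esymm_inv_squares) k
  · apply Complex.ofReal_injective
    rw [Complex.ofReal_tsum]
    push_cast
    exact h
  · have : Unique {S : Finset ℕ+ // S.card = 0} :=
      ⟨⟨⟨∅, rfl⟩⟩, fun S => Subtype.ext (Finset.card_eq_zero.mp S.2)⟩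
    rw [tsum_eq_single default fun S hS => (hS (Subsingleton.elim _ _)).elim]
    have hd : ((default : {S : Finset ℕ+ // S.card = 0}) : Finset ℕ+) = ∅ :=
      Finset.card_eq_zero.mp (default : {S : Finset ℕ+ // S.card = 0}).2
    simp [hd]
end

section
/- For every integer k ≥ 1, the k-th complete homogeneous symmetric function of the reciprocals of the squares of the positive integers satisfies Σ_{M} ∏_{n ∈ M} 1/n^2 = ((2^{2k} − 2)/2^{2k−1}) ζ(2k), where the sum ranges over all multisets M of positive integers of size k (products taken with multiplicity), and ζ is the Riemann zeta function. -/
open Finset Filter Topology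

/-- Splitting the complete homogeneous symmetric sum over `insert a s` according to whether the
multiset contains `a`. -/
theorem sum_sym_insert_succ {α R : Type*} [DecidableEq α] [CommSemiring R] (x : α → R)
    {a : α} {s : Finset α} (ha : a ∉ s) (k : ℕ) :
    ∑ M ∈ (insert a s).sym (k + 1), ((M : Multiset α).map x).prod =
      ∑ M ∈ s.sym (k + 1), ((M : Multiset α).map x).prod +
        x a * ∑ M ∈ (insert a s).sym k, ((M : Multiset α).map x).prod := by
  have hmem : {M ∈ (insert a s).sym (k + 1) | a ∈ M} = ((insert a s).sym k).image (Sym.cons a) := by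
    ext M
    simp only [mem_filter, mem_sym_iff, mem_image]
    constructor
    · rintro ⟨h, haM⟩
      obtain ⟨T, rfl⟩ : ∃ T, M = a ::ₛ T := ⟨M.erase a haM, (Sym.cons_erase haM).symm⟩
      exact ⟨T, fun b hb => h b (Sym.mem_cons_of_mem hb), rfl⟩
    · rintro ⟨T, h, rfl⟩
      refine ⟨fun b hb => ?_, Sym.mem_cons_self _ _⟩
      rcases Sym.mem_cons.1 hb with rfl | hb
      · exact mem_insert_self _ _
      · exact h b hb
  have hnot : {M ∈ (insert a s).sym (k + 1) | a ∉ M} = s.sym (k + 1) := by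
    ext M
    simp only [mem_filter, mem_sym_iff, mem_insert]
    constructor
    · rintro ⟨h, haM⟩ b hb
      exact (h b hb).resolve_left fun hba => haM (hba ▸ hb)
    · exact fun h => ⟨fun b hb => Or.inr (h b hb), fun haM => ha (h a haM)⟩
  rw [← sum_filter_not_add_sum_filter _ (fun M => a ∈ M), hmem, hnot,
    sum_image fun _ _ _ _ h => Sym.cons_inj_right a _ _ |>.1 h, mul_sum]
  congr 1
  refine sum_congr rfl fun M _ => ?_
  rw [Sym.coe_cons, Multiset.map_cons, Multiset.prod_cons]

/-- The product `∏_{j < i} (N - j) / (N + j + 1)`, equal to `N!² / ((N - i)! (N + i)!)` for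
`i ≤ N` and to `0` for `i > N`. -/
noncomputable def centralRatio (N i : ℕ) : ℝ :=
  ∏ j ∈ range i, ((N : ℝ) - j) / (N + j + 1)

theorem centralRatio_succ (N i : ℕ) :
    centralRatio N (i + 1) = centralRatio N i * (((N : ℝ) - i) / (N + i + 1)) :=
  prod_range_succ _ _

theorem centralRatio_succ_self (N : ℕ) : centralRatio N (N + 1) = 0 := by
  simp [centralRatio_succ]

theorem abs_centralRatio_le_one (N i : ℕ) : |centralRatio N i| ≤ 1 := by
  rw [centralRatio, abs_prod]
  refine prod_le_one (fun _ _ => abs_nonneg _) fun j _ => ?_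
  have hN : (0 : ℝ) ≤ N := N.cast_nonneg
  have hj : (0 : ℝ) ≤ j := j.cast_nonneg
  rw [abs_div, abs_of_pos (by positivity : (0 : ℝ) < N + j + 1)]
  refine div_le_one_of_le₀ (abs_le.2 ⟨?_, ?_⟩) (by positivity) <;> linarith

theorem tendsto_centralRatio (i : ℕ) : Tendsto (fun N => centralRatio N i) atTop (𝓝 1) := by
  have h (j : ℕ) : Tendsto (fun N : ℕ => ((N : ℝ) - j) / (N + j + 1)) atTop (𝓝 1) := by
    have h0 : Tendsto (fun N : ℕ => 1 - (2 * j + 1 : ℝ) / ((N : ℝ) + (j + 1))) atTop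
        (𝓝 (1 - 0)) :=
      tendsto_const_nhds.sub <| tendsto_const_nhds.div_atTop <|
        tendsto_atTop_add_const_right _ _ tendsto_natCast_atTop_atTop
    rw [sub_zero] at h0
    refine h0.congr fun N => ?_
    field_simp
    ring
  simpa [centralRatio] using tendsto_finsetProd (range i) fun j _ => h j

theorem centralRatio_succ_left_mul (N i : ℕ) :
    centralRatio (N + 1) i * (((N : ℝ) + 1 - i) * (N + 1 + i)) =
      centralRatio N i * ((N : ℝ) + 1) ^ 2 := by
  induction i with
  | zero => simp [centralRatio]; ring
  | succ i ih =>
    rw [centralRatio_succ, centralRatio_succ]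
    have h1 : (N : ℝ) + 1 + i ≠ 0 := by positivity
    have h2 : (N : ℝ) + i + 1 ≠ 0 := by positivity
    have h3 : (N : ℝ) + 1 + i + 1 ≠ 0 := by positivity
    push_cast
    field_simp
    linear_combination ((N : ℝ) - i) * (N + 1 + i + 1) * ih

theorem sum_range_alternating_centralRatio (N m : ℕ) :
    2 * ∑ i ∈ range m, (-1 : ℝ) ^ i * centralRatio (N + 1) (i + 1) =
      1 - (-1) ^ m * centralRatio (N + 1) m * ((N + 1 - m) / (N + 1)) := by
  induction m with
  | zero =>
    have : (N : ℝ) + 1 ≠ 0 := by positivity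
    simp [centralRatio, this]
  | succ m ih =>
    rw [sum_range_succ, mul_add, ih, centralRatio_succ]
    have h1 : (N : ℝ) + 1 ≠ 0 := by positivity
    have h2 : (N : ℝ) + 1 + m + 1 ≠ 0 := by positivity
    push_cast
    field_simp
    ring

/-- The partial fraction evaluation of `h_k(1/1², …, 1/N²)`. -/
theorem sum_sym_inv_squares (k N : ℕ) (h : k ≠ 0 ∨ N ≠ 0) :
    ∑ M ∈ ((range N).image Nat.succPNat).sym k,
        ((M : Multiset ℕ+).map (fun n : ℕ+ => 1 / (n : ℝ) ^ 2)).prod =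
      2 * ∑ i ∈ range N, (-1 : ℝ) ^ i / ((i : ℝ) + 1) ^ (2 * k) * centralRatio N (i + 1) := by
  induction k generalizing N with
  | zero =>
    obtain ⟨N, rfl⟩ := Nat.exists_eq_succ_of_ne_zero (h.resolve_left (by simp))
    have := sum_range_alternating_centralRatio N (N + 1)
    simp at this
    simp only [sym_zero, sum_singleton, mul_zero, pow_zero, div_one, this]
    exact Multiset.prod_zero
  | succ k ihk =>
    induction N with
    | zero => simp
    | succ N ihN =>
      have hN : N.succPNat ∉ (range N).image Nat.succPNat := by simp
      have key := ihk (N + 1) (Or.inr N.succ_ne_zero)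
      rw [range_add_one, image_insert] at key ⊢
      rw [sum_sym_insert_succ _ hN, key, ihN (Or.inl k.succ_ne_zero), ← range_add_one]
      have hlast : ∑ i ∈ range N,
            (-1 : ℝ) ^ i / ((i : ℝ) + 1) ^ (2 * (k + 1)) * centralRatio N (i + 1) =
          ∑ i ∈ range (N + 1),
            (-1 : ℝ) ^ i / ((i : ℝ) + 1) ^ (2 * (k + 1)) * centralRatio N (i + 1) := by
        rw [sum_range_succ, centralRatio_succ_self, mul_zero, add_zero]
      rw [hlast, mul_left_comm, ← mul_add, mul_sum, ← sum_add_distrib]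
      congr 1
      refine sum_congr rfl fun i _ => ?_
      have hrec := centralRatio_succ_left_mul N (i + 1)
      have h1 : (N : ℝ) + 1 ≠ 0 := by positivity
      have h2 : (i : ℝ) + 1 ≠ 0 := by positivity
      simp only [Nat.succPNat_coe, Nat.succ_eq_add_one]
      push_cast at hrec ⊢
      rw [mul_add 2 k 1, pow_add]
      field_simp
      linear_combination -hrec

theorem summable_one_div_succ_pow {m : ℕ} (hm : 1 < m) :
    Summable fun i : ℕ => 1 / ((i : ℝ) + 1) ^ m := by
  simpa using (summable_nat_add_iff 1).2 (Real.summable_one_div_nat_pow.2 hm)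

/-- The Dirichlet eta function at an integer in terms of the zeta function. -/
theorem tsum_alternating_one_div_succ_pow {m : ℕ} (hm : 1 < m) :
    ∑' i : ℕ, (-1 : ℝ) ^ i / ((i : ℝ) + 1) ^ m =
      (1 - 2 / 2 ^ m) * ∑' i : ℕ, 1 / ((i : ℝ) + 1) ^ m := by
  have hs := summable_one_div_succ_pow hm
  have hodd (j : ℕ) :
      1 / (((2 * j + 1 : ℕ) : ℝ) + 1) ^ m = 1 / 2 ^ m * (1 / ((j : ℝ) + 1) ^ m) := by
    push_cast
    rw [show (2 * (j : ℝ) + 1 + 1) = 2 * (j + 1) by ring, mul_pow, one_div_mul_one_div]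
  have he : Summable fun j : ℕ => 1 / (((2 * j : ℕ) : ℝ) + 1) ^ m :=
    hs.comp_injective (i := fun j : ℕ => 2 * j) fun a b hab => by simpa using hab
  have ho : Summable fun j : ℕ => 1 / (((2 * j + 1 : ℕ) : ℝ) + 1) ^ m :=
    hs.comp_injective (i := fun j : ℕ => 2 * j + 1) fun a b hab => by simpa using hab
  have hplus := tsum_even_add_odd (f := fun i : ℕ => 1 / ((i : ℝ) + 1) ^ m) he ho
  have hminus := tsum_even_add_odd (f := fun i : ℕ => (-1 : ℝ) ^ i / ((i : ℝ) + 1) ^ m)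
    (by simpa [pow_mul] using he) (by simpa [pow_succ, pow_mul, neg_div] using ho.neg)
  have ho_half := tsum_congr (L := .unconditional ℕ) hodd
  rw [tsum_mul_left] at ho_half
  have hneg : ∑' j : ℕ, (-1 : ℝ) ^ (2 * j + 1) / (((2 * j + 1 : ℕ) : ℝ) + 1) ^ m =
      -∑' j : ℕ, 1 / (((2 * j + 1 : ℕ) : ℝ) + 1) ^ m := by
    rw [← tsum_neg]
    exact tsum_congr fun j => by simp [pow_succ, pow_mul, neg_div]
  have hpos : ∑' j : ℕ, (-1 : ℝ) ^ (2 * j) / (((2 * j : ℕ) : ℝ) + 1) ^ m =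
      ∑' j : ℕ, 1 / (((2 * j : ℕ) : ℝ) + 1) ^ m :=
    tsum_congr fun j => by simp [pow_mul]
  rw [hneg, hpos] at hminus
  linear_combination -hminus + hplus - 2 * ho_half

theorem tendsto_sum_sym_inv_squares {k : ℕ} (hk : k ≠ 0) :
    Tendsto (fun N => ∑ M ∈ ((range N).image Nat.succPNat).sym k,
        ((M : Multiset ℕ+).map (fun n : ℕ+ => 1 / (n : ℝ) ^ 2)).prod) atTop
      (𝓝 (2 * ∑' i : ℕ, (-1 : ℝ) ^ i / ((i : ℝ) + 1) ^ (2 * k))) := by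
  simp_rw [fun N => sum_sym_inv_squares k N (Or.inl hk)]
  refine Tendsto.const_mul 2 ?_
  have hbound := summable_one_div_succ_pow (m := 2 * k) (by omega)
  have h := tendsto_tsum_of_dominated_convergence (𝓕 := atTop)
    (f := fun (N i : ℕ) => if i < N then
      (-1 : ℝ) ^ i / ((i : ℝ) + 1) ^ (2 * k) * centralRatio N (i + 1) else 0)
    (g := fun i : ℕ => (-1 : ℝ) ^ i / ((i : ℝ) + 1) ^ (2 * k)) hbound
    (fun i => by
      have := (tendsto_centralRatio (i + 1)).const_mul ((-1 : ℝ) ^ i / ((i : ℝ) + 1) ^ (2 * k))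
      rw [mul_one] at this
      refine this.congr' ?_
      filter_upwards [eventually_gt_atTop i] with N hN
      rw [if_pos hN])
    (Eventually.of_forall fun N i => by
      split_ifs
      · rw [norm_mul, norm_div, norm_pow, norm_neg, norm_one, one_pow,
          Real.norm_of_nonneg (by positivity : (0 : ℝ) ≤ ((i : ℝ) + 1) ^ (2 * k))]
        exact mul_le_of_le_one_right (by positivity) (abs_centralRatio_le_one N (i + 1))
      · rw [norm_zero]
        positivity)
  refine h.congr fun N => ?_
  rw [tsum_eq_sum (s := range N) fun i hi => if_neg (by simpa using hi)]
  exact sum_congr rfl fun i hi => if_pos (mem_range.1 hi)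

/-- A nonnegative family whose sums along an exhausting monotone sequence of finsets converge
has the limit as its sum. -/
theorem hasSum_of_nonneg_of_tendsto_of_monotone {α : Type*} {f : α → ℝ} (hf : ∀ a, 0 ≤ f a)
    {s : ℕ → Finset α} (hs : Monotone s) (hmem : ∀ a, ∃ N, a ∈ s N) {L : ℝ}
    (hL : Tendsto (fun N => ∑ a ∈ s N, f a) atTop (𝓝 L)) : HasSum f L := by
  have hat : Tendsto s atTop atTop := tendsto_atTop_finset_of_monotone hs hmem
  have hmono : Monotone fun N => ∑ a ∈ s N, f a := fun _ _ h =>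
    sum_le_sum_of_subset_of_nonneg (hs h) fun a _ _ => hf a
  have hsum : Summable f := summable_of_sum_le hf fun u => by
    obtain ⟨N, hN⟩ := (hat.eventually_ge_atTop u).exists
    exact (sum_le_sum_of_subset_of_nonneg hN fun a _ _ => hf a).trans (hmono.ge_of_tendsto hL N)
  exact tendsto_nhds_unique (hsum.hasSum.comp hat) hL ▸ hsum.hasSum

theorem exists_mem_sym_image_succPNat {k : ℕ} (M : Sym ℕ+ k) :
    ∃ N, M ∈ ((range N).image Nat.succPNat).sym k := by
  refine ⟨(M : Multiset ℕ+).toFinset.sup (fun n => (n : ℕ)), mem_sym_iff.2 fun n hn => ?_⟩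
  have hle : (n : ℕ) ≤ (M : Multiset ℕ+).toFinset.sup (fun n => (n : ℕ)) :=
    le_sup (f := fun n : ℕ+ => (n : ℕ)) (Multiset.mem_toFinset.2 hn)
  refine mem_image.2 ⟨n.natPred, mem_range.2 ?_, n.succPNat_natPred⟩
  have := n.natPred_add_one
  omega

/-- For `k ≥ 1`, the `k`-th complete homogeneous symmetric function of `1/1², 1/2², 1/3², …`
satisfies `∑_{M} ∏_{n ∈ M} 1/n² = ((2^{2k} − 2)/2^{2k−1}) ζ(2k)`, the sum ranging over all
multisets `M` of positive integers of size `k` (products taken with multiplicity), with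
`ζ(2k) = ∑_{n≥1} 1/n^{2k}`. -/
theorem hsymm_inv_squares (k : ℕ) (hk : 1 ≤ k) :
    ∑' M : Sym ℕ+ k, ((M : Multiset ℕ+).map (fun n => 1 / (n : ℝ) ^ 2)).prod =
      ((2 ^ (2 * k) - 2) / 2 ^ (2 * k - 1) : ℝ) * ∑' n : ℕ+, 1 / (n : ℝ) ^ (2 * k) := by
  have hmono : Monotone fun N => ((range N).image Nat.succPNat).sym k := fun _ _ h =>
    sym_mono (image_mono _ (range_mono h)) k
  have hsum := hasSum_of_nonneg_of_tendsto_of_monotone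
    (fun M : Sym ℕ+ k => Multiset.prod_nonneg fun x hx => by
      obtain ⟨n, -, rfl⟩ := Multiset.mem_map.1 hx
      positivity)
    hmono exists_mem_sym_image_succPNat (tendsto_sum_sym_inv_squares (by omega))
  have hcoe (M : Sym ℕ+ k) :
      ((M : Multiset ℕ+).map (fun n => 1 / (n : ℝ) ^ 2)).prod =
        ((M : Multiset ℕ+).map (fun n : ℕ+ => 1 / (n : ℝ) ^ 2)).prod := by
    simp [Multiset.bind_def, Multiset.pure_def, Multiset.bind_singleton]
  rw [tsum_congr hcoe, hsum.tsum_eq, tsum_alternating_one_div_succ_pow (by omega),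
    tsum_pnat_eq_tsum_succ (f := fun n : ℕ => 1 / (n : ℝ) ^ (2 * k))]
  obtain ⟨m, hm⟩ : ∃ m, 2 * k = m + 1 := ⟨2 * k - 1, by omega⟩
  simp only [hm, Nat.cast_add, Nat.cast_one, Nat.add_sub_cancel]
  rw [← mul_assoc]
  congr 1
  rw [pow_succ]
  field_simp
end

section
/- For every integer k ≥ 1, the Riemann zeta function at even integer arguments satisfies the recursion ζ(2k) = (-1)^{k-1} k π^{2k}/(2k+1)! + Σ_{m=1}^{k-1} (-1)^{m-1} (2m · π^{2m}/(2m+1)!) (1 − 2^{2(m−k)+1}) ζ(2k − 2m), where the summation is empty (equal to zero) when k = 1. -/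
open Finset Nat in
theorem sum_choose_mul_bernoulli_mul_pow (n : ℕ) (x : ℝ) :
    ∑ i ∈ range (n + 1), (n.choose i : ℝ) * bernoulli i * x ^ (n - i) = bernoulliFun n x := by
  simp only [bernoulliFun, Polynomial.bernoulli, Polynomial.map_sum, Polynomial.eval_finsetSum,
    Polynomial.map_monomial, Polynomial.eval_monomial]
  refine sum_congr rfl fun i _ => ?_
  simp [mul_comm]

open Finset Nat in
theorem sum_choose_mul_two_pow_sub_one_mul_bernoulli {n : ℕ} (hn : 2 ≤ n) :
    ∑ i ∈ range (n + 1), (n.choose i : ℝ) * ((2 ^ i / 2 - 1) * bernoulli i) =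
      -(2 ^ n / 2 * bernoulli n) := by
  have h_half := sum_choose_mul_bernoulli_mul_pow n 2⁻¹
  have h_one := sum_choose_mul_bernoulli_mul_pow n 1
  rw [bernoulliFun_eval_half] at h_half
  rw [bernoulliFun_eval_one, bernoulliFun_eval_zero, if_neg (by lia)] at h_one
  have key : ∑ i ∈ range (n + 1), (n.choose i : ℝ) * ((2 ^ i / 2 - 1) * bernoulli i) =
      2 ^ n / 2 * ∑ i ∈ range (n + 1), (n.choose i : ℝ) * bernoulli i * 2⁻¹ ^ (n - i) -
        ∑ i ∈ range (n + 1), (n.choose i : ℝ) * bernoulli i * 1 ^ (n - i) := by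
    rw [mul_sum, ← sum_sub_distrib]
    refine sum_congr rfl fun i hi => ?_
    have hin : i ≤ n := by simpa [Nat.lt_succ_iff] using hi
    have hpow : (2 : ℝ) ^ n = 2 ^ i * 2 ^ (n - i) := by rw [← pow_add, Nat.add_sub_cancel' hin]
    rw [hpow, inv_pow, one_pow]
    field_simp
  rw [key, h_half, h_one]
  field_simp
  ring

open Finset Nat in
/-- The coefficients `(2 ^ i / 2 - 1) B_i` vanish at all odd `i`, so only even indices remain. -/
theorem sum_choose_two_mul_mul_bernoulli {n k : ℕ} (hn : 2 ≤ n) (hk : k = n / 2) :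
    ∑ j ∈ range (k + 1),
        (n.choose (2 * j) : ℝ) * ((2 ^ (2 * j) / 2 - 1) * bernoulli (2 * j)) =
      -(2 ^ n / 2 * bernoulli n) := by
  rw [← sum_choose_mul_two_pow_sub_one_mul_bernoulli hn]
  refine sum_of_injOn (fun j => 2 * j) (fun a _ b _ h => by simpa using h)
    (fun j hj => ?_) (fun i hi hni => ?_) (fun j _ => rfl)
  · simp only [coe_range, Set.mem_Iio] at hj ⊢
    lia
  · rcases Nat.even_or_odd' i with ⟨j, rfl | rfl⟩
    · refine absurd ⟨j, ?_, rfl⟩ hni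
      simp only [coe_range, Set.mem_Iio, mem_range] at hi ⊢
      lia
    · rcases Nat.eq_zero_or_pos j with rfl | hj
      · norm_num
      · rw [bernoulli_eq_zero_of_odd (odd_two_mul_add_one j) (by lia)]
        simp

open Finset Nat in
theorem sum_two_mul_div_factorial_mul_bernoulli {k : ℕ} (hk : 1 ≤ k) :
    ∑ m ∈ range (k + 1), (2 * m : ℝ) / (2 * m + 1)! *
        ((2 ^ (2 * (k - m)) / 2 - 1) * bernoulli (2 * (k - m)) / (2 * (k - m))!) =
      -(2 ^ (2 * k) / 2 * bernoulli (2 * k) / (2 * k)!) := by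
  have h_even := sum_choose_two_mul_mul_bernoulli (n := 2 * k) (k := k) (by lia) (by lia)
  have h_odd := sum_choose_two_mul_mul_bernoulli (n := 2 * k + 1) (k := k) (by lia) (by lia)
  rw [bernoulli_eq_zero_of_odd (odd_two_mul_add_one k) (by lia)] at h_odd
  have key : ∑ m ∈ range (k + 1), (2 * m : ℝ) / (2 * m + 1)! *
        ((2 ^ (2 * (k - m)) / 2 - 1) * bernoulli (2 * (k - m)) / (2 * (k - m))!) =
      (∑ j ∈ range (k + 1), ((2 * k).choose (2 * j) : ℝ) *
          ((2 ^ (2 * j) / 2 - 1) * bernoulli (2 * j))) / (2 * k)! -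
        (∑ j ∈ range (k + 1), ((2 * k + 1).choose (2 * j) : ℝ) *
          ((2 ^ (2 * j) / 2 - 1) * bernoulli (2 * j))) / (2 * k + 1)! := by
    rw [← sum_range_reflect, sum_div, sum_div, ← sum_sub_distrib]
    refine sum_congr rfl fun j hj => ?_
    obtain ⟨m, rfl⟩ := Nat.exists_eq_add_of_le (Nat.lt_succ_iff.mp (mem_range.mp hj))
    rw [show j + m + 1 - 1 - j = m by lia, show j + m - m = j by lia,
      Nat.cast_choose ℝ (show 2 * j ≤ 2 * (j + m) by lia),
      Nat.cast_choose ℝ (show 2 * j ≤ 2 * (j + m) + 1 by lia),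
      show 2 * (j + m) - 2 * j = 2 * m by lia,
      show 2 * (j + m) + 1 - 2 * j = 2 * m + 1 by lia]
    rw [Nat.factorial_succ (2 * m)]
    push_cast
    field_simp
    ring
  rw [key, h_even, h_odd]
  simp [neg_div]

/-- For `k ≥ 1`, the Riemann zeta function at even integer arguments satisfies
`ζ(2k) = (-1)^{k-1} k π^{2k}/(2k+1)!
  + ∑_{m=1}^{k-1} (-1)^{m-1} (2m π^{2m}/(2m+1)!) (1 − 2^{2(m−k)+1}) ζ(2k−2m)`. -/
theorem zeta_even_recursion (k : ℕ) (hk : 1 ≤ k) :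
    riemannZeta (2 * k) =
      (-1) ^ (k - 1) * (k : ℂ) * (Real.pi : ℂ) ^ (2 * k) / (Nat.factorial (2 * k + 1) : ℂ) +
        ∑ m ∈ Finset.Icc 1 (k - 1), (-1) ^ (m - 1) *
          (2 * (m : ℂ) * (Real.pi : ℂ) ^ (2 * m) / (Nat.factorial (2 * m + 1) : ℂ)) *
          (1 - (2 : ℂ) ^ (2 * ((m : ℤ) - (k : ℤ)) + 1)) * riemannZeta (2 * (k - m)) := by
  have h := congrArg ((↑) : ℝ → ℂ) (sum_two_mul_div_factorial_mul_bernoulli hk)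
  push_cast at h
  obtain ⟨n, rfl⟩ := Nat.exists_eq_add_of_le' hk
  rw [Finset.sum_range_succ, Finset.range_eq_Ico, Finset.sum_eq_sum_Ico_succ_bot (by lia)] at h
  have hterm : ∀ m ∈ Finset.Ico 1 (n + 1), (-1) ^ (m - 1) *
        (2 * (m : ℂ) * (Real.pi : ℂ) ^ (2 * m) / (Nat.factorial (2 * m + 1) : ℂ)) *
        (1 - (2 : ℂ) ^ (2 * ((m : ℤ) - ((n + 1 : ℕ) : ℤ)) + 1)) *
        riemannZeta (2 * ((n + 1 : ℕ) - m)) =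
      (-1) ^ (n + 1) * (Real.pi : ℂ) ^ (2 * (n + 1)) *
        ((2 * m : ℂ) / (Nat.factorial (2 * m + 1) : ℂ) *
        ((2 ^ (2 * (n + 1 - m)) / 2 - 1) * bernoulli (2 * (n + 1 - m)) /
          (Nat.factorial (2 * (n + 1 - m)) : ℂ))) := by
    intro m hm
    obtain ⟨hm1, hmn⟩ := Finset.mem_Ico.mp hm
    obtain ⟨j, hj⟩ := Nat.exists_eq_add_of_lt hmn
    obtain ⟨l, rfl⟩ := Nat.exists_eq_add_of_le' hm1
    obtain rfl : n = l + j + 1 := by lia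
    have hz := riemannZeta_two_mul_nat (k := j + 1) (by lia)
    have hexp : (2 : ℂ) ^ (2 * (((l + 1 : ℕ) : ℤ) - ((l + j + 1 + 1 : ℕ) : ℤ)) + 1) =
        2 / 2 ^ (2 * (j + 1)) := by
      rw [show 2 * (((l + 1 : ℕ) : ℤ) - ((l + j + 1 + 1 : ℕ) : ℤ)) + 1 =
        1 - ((2 * (j + 1) : ℕ) : ℤ) by push_cast; ring, zpow_sub₀ two_ne_zero, zpow_one,
        zpow_natCast]
    rw [hexp, show l + j + 1 + 1 - (l + 1) = j + 1 by lia,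
      show (2 : ℂ) * (((l + j + 1 + 1 : ℕ) : ℂ) - ((l + 1 : ℕ) : ℂ)) = 2 * ((j + 1 : ℕ) : ℂ) by
        push_cast; ring, hz]
    rw [show 2 * (j + 1) - 1 = 2 * j + 1 by lia, show l + 1 - 1 = l by lia]
    field_simp
    ring
  rw [show n + 1 - 1 = n by lia, show Finset.Icc 1 n = Finset.Ico 1 (n + 1) by ext; simp,
    Finset.sum_congr rfl hterm, ← Finset.mul_sum]
  have hz := riemannZeta_two_mul_nat (k := n + 1) (by lia)
  rw [hz]
  simp only [Nat.cast_zero, mul_zero, zero_div, zero_mul, zero_add, Nat.sub_self, pow_zero,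
    bernoulli_zero, Nat.factorial_zero, Nat.cast_one, Rat.cast_one] at h
  rw [eq_sub_of_add_eq h]
  rw [show 2 * (n + 1) - 1 = 2 * n + 1 by lia]
  push_cast
  field_simp
  ring
end
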